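/- Let A, g be positive integers, χ a Dirichlet character modulo g, α a real number, and suppose there exist integers a and q ≥ 1 with gcd(a, q) = 1 and |α − a/q| ≤ 1/q². Then there is a constant C (depending only on A and g) such that for all real x ≥ 2 and M ≥ 1, ∑_{m ≤ M} |∑_{n: mn ≤ x, A | n} χ(n/A)·e(αmn)| ≤ C·(M + x/q + q)·log(2qx), where the inner sum is over positive integers n divisible by A with mn ≤ x, and e(θ) = e^{2πiθ}. -/

import Mathlib

attribute [local instance] Classical.propDecidable

/-- `e θ = e^{2πiθ}`. -/
noncomputable def e (θ : ℝ) : ℂ := Complex.exp (2 * Real.pi * Complex.I * θ)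

lemma norm_e (θ : ℝ) : ‖e θ‖ = 1 := by
  rw [e, Complex.norm_exp]
  simp

lemma e_add (s t : ℝ) : e (s + t) = e s * e t := by
  simp only [e, ← Complex.exp_add]
  push_cast
  ring_nf

lemma e_intCast (n : ℤ) : e n = 1 := by
  rw [e, Complex.exp_eq_one_iff]
  exact ⟨n, by push_cast; ring⟩

/-- Jordan's inequality in terms of the distance to the nearest integer. -/
lemma four_mul_abs_sub_round_le_norm_e_sub_one (φ : ℝ) :
    4 * |φ - round φ| ≤ ‖e φ - 1‖ := by
  set f := φ - round φ with hf
  have hφ : e φ = e f := by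
    have h : φ = f + (round φ : ℤ) := by rw [hf]; ring
    conv_lhs => rw [h]
    rw [e_add, e_intCast, mul_one]
  have hef : e f = Complex.exp (Complex.I * ((2 * Real.pi * f : ℝ) : ℂ)) := by
    rw [e]; push_cast; ring_nf
  have hhalf : |f| ≤ 1 / 2 := abs_sub_round φ
  have hpi := Real.pi_pos
  have habs : |Real.pi * f| = Real.pi * |f| := by rw [abs_mul, abs_of_pos hpi]
  have hsin := Real.mul_abs_le_abs_sin (x := Real.pi * f) (by rw [habs]; nlinarith)
  rw [habs, show 2 / Real.pi * (Real.pi * |f|) = 2 * |f| by field_simp] at hsin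
  rw [hφ, hef, Complex.norm_exp_I_mul_ofReal_sub_one, Real.norm_eq_abs, abs_mul,
    show 2 * Real.pi * f / 2 = Real.pi * f by ring, abs_two]
  linarith

/-- A partial sum of a sequence that is multiplied by `z` under a shift by `g`. -/
lemma norm_sub_one_mul_norm_sum_range_le {w : ℕ → ℂ} {z : ℂ} {g : ℕ}
    (hw : ∀ k, ‖w k‖ ≤ 1) (hshift : ∀ k, w (g + k) = z * w k) (P : ℕ) :
    ‖z - 1‖ * ‖∑ k ∈ Finset.range P, w k‖ ≤ 2 * g := by
  have h₁ := Finset.sum_range_add w g P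
  have h₂ := Finset.sum_range_add w P g
  rw [add_comm P g, h₁] at h₂
  simp only [hshift, ← Finset.mul_sum] at h₂
  have hbound : ∀ v : ℕ → ℂ, (∀ k, ‖v k‖ ≤ 1) → ‖∑ k ∈ Finset.range g, v k‖ ≤ g := by
    intro v hv
    simpa using norm_sum_le_of_le (Finset.range g) (fun k _ => hv k)
  have heq : (z - 1) * ∑ k ∈ Finset.range P, w k =
      ∑ k ∈ Finset.range g, w (P + k) - ∑ k ∈ Finset.range g, w k := by
    linear_combination h₂
  rw [← norm_mul, heq]
  have := norm_sub_le (∑ k ∈ Finset.range g, w (P + k)) (∑ k ∈ Finset.range g, w k)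
  have := hbound w hw
  have := hbound (fun k => w (P + k)) (fun k => hw _)
  linarith

/-- Reindexing the inner sum by `n = A (k + 1)`. -/
lemma sum_filter_dvd_eq_sum_range {A m : ℕ} (hA : 0 < A) (hm : 0 < m) {x : ℝ} (hx : 0 ≤ x)
    (F : ℕ → ℂ) :
    ∑ n ∈ (Finset.Icc 1 ⌊x⌋₊).filter (fun n : ℕ => ((m * n : ℕ) : ℝ) ≤ x ∧ A ∣ n), F n =
      ∑ k ∈ Finset.range (⌊x⌋₊ / m / A), F (A * (k + 1)) := by
  symm
  refine Finset.sum_bij (fun k _ => A * (k + 1)) ?_ ?_ ?_ (fun _ _ => rfl)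
  · intro k hk
    rw [Finset.mem_range, Nat.lt_iff_add_one_le, Nat.le_div_iff_mul_le hA,
      Nat.le_div_iff_mul_le hm] at hk
    have hle : m * (A * (k + 1)) ≤ ⌊x⌋₊ := by linarith
    rw [Finset.mem_filter, Finset.mem_Icc, ← Nat.le_floor_iff hx]
    exact ⟨⟨Nat.mul_pos hA k.succ_pos, (Nat.le_mul_of_pos_left _ hm).trans hle⟩, hle,
      Nat.dvd_mul_right _ _⟩
  · intro k _ l _ h
    have := Nat.eq_of_mul_eq_mul_left hA h
    omega
  · intro n hn
    rw [Finset.mem_filter, Finset.mem_Icc, ← Nat.le_floor_iff hx] at hn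
    obtain ⟨⟨hn1, -⟩, hle, c, rfl⟩ := hn
    have hc : 0 < c := Nat.pos_of_mul_pos_left (Nat.lt_of_lt_of_le Nat.zero_lt_one hn1)
    obtain ⟨k, rfl⟩ : ∃ k, c = k + 1 := ⟨c - 1, by omega⟩
    refine ⟨k, ?_, rfl⟩
    rw [Finset.mem_range, Nat.lt_iff_add_one_le, Nat.le_div_iff_mul_le hA,
      Nat.le_div_iff_mul_le hm]
    linarith

/-- Trivial bound and geometric-series bound for the inner sum. -/
lemma norm_inner_sum_le {A g m : ℕ} (hA : 0 < A) (hm : 0 < m)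
    (χ : DirichletCharacter ℂ g) (α : ℝ) {x : ℝ} (hx : 0 ≤ x) :
    let T := ‖∑ n ∈ (Finset.Icc 1 ⌊x⌋₊).filter
      (fun n : ℕ => ((m * n : ℕ) : ℝ) ≤ x ∧ A ∣ n),
        χ ((n / A : ℕ) : ZMod g) * e (α * (m * n))‖
    T ≤ (⌊x⌋₊ / m / A : ℕ) ∧
      T * |α * (A * g * m : ℕ) - round (α * (A * g * m : ℕ))| ≤ g := by
  intro T
  set w : ℕ → ℂ := fun k => χ ((k + 1 : ℕ) : ZMod g) * e (α * (m * (A * (k + 1) : ℕ))) with hw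
  have hT : T = ‖∑ k ∈ Finset.range (⌊x⌋₊ / m / A), w k‖ := by
    simp only [T, hw]
    rw [sum_filter_dvd_eq_sum_range hA hm hx]
    simp only [Nat.mul_div_cancel_left _ hA]
  have hw1 : ∀ k, ‖w k‖ ≤ 1 := by
    intro k
    rw [hw]
    simp only [norm_mul, norm_e, mul_one]
    exact χ.norm_le_one _
  have hshift : ∀ k, w (g + k) = e (α * (A * g * m : ℕ)) * w k := by
    intro k
    simp only [hw]
    rw [show α * (m * (A * (g + k + 1) : ℕ)) =
      α * (A * g * m : ℕ) + α * (m * (A * (k + 1) : ℕ)) by push_cast; ring, e_add]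
    have : ((g + k + 1 : ℕ) : ZMod g) = ((k + 1 : ℕ) : ZMod g) := by push_cast; simp
    rw [this]
    ring
  constructor
  · rw [hT]
    simpa using norm_sum_le_of_le (Finset.range (⌊x⌋₊ / m / A)) (fun k _ => hw1 k)
  · have h := norm_sub_one_mul_norm_sum_range_le hw1 hshift (⌊x⌋₊ / m / A)
    rw [← hT] at h
    have hJ := four_mul_abs_sub_round_le_norm_e_sub_one (α * (A * g * m : ℕ))
    have hT0 : 0 ≤ T := norm_nonneg _
    have hmul := mul_le_mul_of_nonneg_right hJ hT0
    have hg0 : (0 : ℝ) ≤ g := g.cast_nonneg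
    linarith

/-- Multiples of `α` by small integers stay away from the integers. -/
lemma one_div_two_mul_le_abs_sub_round {α : ℝ} {a : ℤ} {q : ℕ} (hq : 1 ≤ q)
    (hcop : Int.gcd a q = 1) (hα : |α - (a : ℝ) / q| ≤ 1 / (q : ℝ) ^ 2) {d : ℤ}
    (hd : d ≠ 0) (hdq : 2 * |d| ≤ q) :
    1 / (2 * (q : ℝ)) ≤ |α * d - round (α * d)| := by
  set z := round (α * d)
  have hq0 : (0 : ℝ) < q := by exact_mod_cast hq
  have hne : a * d - z * q ≠ 0 := by
    intro h
    have hdvd : (q : ℤ) ∣ a * d := ⟨z, by linarith⟩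
    have hqd : (q : ℤ) ∣ d := Int.dvd_of_dvd_mul_right_of_gcd_one hdvd
      (by rw [Int.gcd_comm]; exact hcop)
    have := Int.le_of_dvd (abs_pos.mpr hd) ((dvd_abs _ _).mpr hqd)
    have := abs_pos.mpr hd
    omega
  have hge : (1 : ℝ) ≤ |(a * d - z * q : ℝ)| := by
    exact_mod_cast Int.one_le_abs hne
  have hdR : 2 * |(d : ℝ)| ≤ q := by exact_mod_cast hdq
  have hmain : |(a * d - z * q : ℝ)| ≤ q * |α * d - z| + q * (|(d : ℝ)| * |α - a / q|) := by
    rw [show (a * d - z * q : ℝ) = q * (α * d - z) - q * (d * (α - a / q)) by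
      field_simp; ring]
    refine (abs_sub _ _).trans_eq ?_
    simp only [abs_mul, abs_of_pos hq0]
  have hsmall : q * (|(d : ℝ)| * |α - a / q|) ≤ 1 / 2 := by
    calc q * (|(d : ℝ)| * |α - a / q|) ≤ q * (q / 2 * (1 / (q : ℝ) ^ 2)) := by
          gcongr; linarith
      _ = 1 / 2 := by field_simp
  rw [div_le_iff₀ (by positivity)]
  nlinarith

lemma sum_Icc_one_div_le (n : ℕ) : ∑ j ∈ Finset.Icc 1 n, 1 / (j : ℝ) ≤ 1 + Real.log n := by
  have h := harmonic_le_one_add_log n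
  rw [harmonic_eq_sum_Icc] at h
  push_cast at h
  simpa only [one_div] using h

lemma sum_le_of_injOn_of_mul_le {ι : Type*} {S : Finset ι} {t : ι → ℝ} {j : ι → ℕ} {q : ℕ}
    {B : ℝ} (hB : 0 ≤ B) (hinj : Set.InjOn j S) (hj : ∀ i ∈ S, j i ≤ q)
    (htB : ∀ i ∈ S, t i ≤ B) (htj : ∀ i ∈ S, t i * j i ≤ 2 * q) :
    ∑ i ∈ S, t i ≤ B + 2 * q * (1 + Real.log q) := by
  set F : ℕ → ℝ := fun k => if k = 0 then B else 2 * q * (1 / (k : ℝ)) with hF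
  have hF0 : ∀ k, 0 ≤ F k := by
    intro k
    simp only [hF]
    split_ifs <;> positivity
  calc ∑ i ∈ S, t i ≤ ∑ i ∈ S, F (j i) := by
        refine Finset.sum_le_sum fun i hi => ?_
        simp only [hF]
        split_ifs with h
        · exact htB i hi
        · rw [mul_one_div, le_div_iff₀ (by positivity)]
          exact htj i hi
    _ = ∑ k ∈ S.image j, F k := (Finset.sum_image hinj).symm
    _ ≤ ∑ k ∈ Finset.range (q + 1), F k := by
        refine Finset.sum_le_sum_of_subset_of_nonneg ?_ fun k _ _ => hF0 k
        intro k hk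
        obtain ⟨i, hi, rfl⟩ := Finset.mem_image.mp hk
        exact Finset.mem_range.mpr (Nat.lt_succ_of_le (hj i hi))
    _ = B + 2 * q * ∑ k ∈ Finset.Icc 1 q, 1 / (k : ℝ) := by
        rw [Finset.range_eq_Ico, Finset.sum_eq_sum_Ico_succ_bot (Nat.succ_pos q),
          Finset.mul_sum]
        congr 1
        refine Finset.sum_congr rfl fun k hk => ?_
        rw [Finset.mem_Icc] at hk
        simp only [hF]
        rw [if_neg (by omega)]
    _ ≤ B + 2 * q * (1 + Real.log q) := by
        gcongr
        exact sum_Icc_one_div_le q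

/-- Sum over a family of points that are `1 / (2q)`-separated modulo one. -/
lemma sum_le_of_separated {ι : Type*} {S : Finset ι} {y t : ι → ℝ} {q : ℕ} {B : ℝ}
    (hq : 1 ≤ q) (hB : 0 ≤ B)
    (hsep : ∀ i ∈ S, ∀ j ∈ S, i ≠ j →
      1 / (2 * (q : ℝ)) ≤ |(y i - y j) - round (y i - y j)|)
    (ht0 : ∀ i ∈ S, 0 ≤ t i) (htB : ∀ i ∈ S, t i ≤ B)
    (hty : ∀ i ∈ S, t i * |y i - round (y i)| ≤ 1) :
    ∑ i ∈ S, t i ≤ 2 * B + 4 * q * (1 + Real.log q) := by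
  have hq0 : (0 : ℝ) < q := by exact_mod_cast hq
  set f : ι → ℝ := fun i => y i - round (y i) with hf
  set k : ι → ℕ := fun i => ⌊|f i| * (2 * q)⌋₊
  have hk_le : ∀ i, (k i : ℝ) ≤ |f i| * (2 * q) := fun i => Nat.floor_le (by positivity)
  have hk_lt : ∀ i, |f i| * (2 * q) < k i + 1 := fun i => Nat.lt_floor_add_one _
  have hkq : ∀ i, k i ≤ q := by
    intro i
    have h := abs_sub_round (y i)
    have h' := hk_le i
    have : (k i : ℝ) ≤ q := by simp only [hf] at h'; nlinarith
    exact_mod_cast this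
  have htk : ∀ i ∈ S, t i * k i ≤ 2 * q := by
    intro i hi
    have := mul_le_mul_of_nonneg_left (hk_le i) (ht0 i hi)
    have := hty i hi
    simp only [hf] at *
    nlinarith
  have hinj : ∀ i ∈ S, ∀ j ∈ S, |f i - f j| = |(|f i| - |f j|)| → k i = k j → i = j := by
    intro i hi j hj habs hkij
    by_contra hne
    have h₁ := hsep i hi j hj hne
    have h₂ := round_le (y i - y j) (round (y i) - round (y j))
    push_cast at h₂
    rw [show y i - y j - (round (y i) - round (y j) : ℝ) = f i - f j by simp only [hf]; ring,
      habs] at h₂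
    have h₃ : |(|f i| - |f j|)| < 1 / (2 * q) := by
      have hi₁ := hk_le i
      have hi₂ := hk_lt i
      have hj₁ := hk_le j
      have hj₂ := hk_lt j
      rw [hkij] at hi₁ hi₂
      have h2q : (0 : ℝ) < 2 * q := by positivity
      have h : |(|f i| - |f j|) * (2 * q)| < 1 := by
        rw [abs_lt]
        constructor <;> linarith
      rwa [abs_mul, abs_of_pos h2q, ← lt_div_iff₀ h2q] at h
    linarith
  have hpos : ∑ i ∈ S with 0 ≤ f i, t i ≤ B + 2 * q * (1 + Real.log q) := by
    refine sum_le_of_injOn_of_mul_le hB (j := k) ?_ (fun i _ => hkq i)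
      (fun i hi => htB i (Finset.mem_filter.mp hi).1)
      (fun i hi => htk i (Finset.mem_filter.mp hi).1)
    intro i hi j hj
    obtain ⟨hi, hi0⟩ := Finset.mem_filter.mp hi
    obtain ⟨hj, hj0⟩ := Finset.mem_filter.mp hj
    exact hinj i hi j hj (by rw [abs_of_nonneg hi0, abs_of_nonneg hj0])
  have hneg : ∑ i ∈ S with ¬ 0 ≤ f i, t i ≤ B + 2 * q * (1 + Real.log q) := by
    refine sum_le_of_injOn_of_mul_le hB (j := k) ?_ (fun i _ => hkq i)
      (fun i hi => htB i (Finset.mem_filter.mp hi).1)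
      (fun i hi => htk i (Finset.mem_filter.mp hi).1)
    intro i hi j hj
    obtain ⟨hi, hi0⟩ := Finset.mem_filter.mp hi
    obtain ⟨hj, hj0⟩ := Finset.mem_filter.mp hj
    refine hinj i hi j hj ?_
    rw [abs_of_neg (not_le.mp hi0), abs_of_neg (not_le.mp hj0), ← abs_neg]
    ring_nf
  rw [← Finset.sum_filter_add_sum_filter_not S (fun i => 0 ≤ f i)]
  linarith

/-- The classical bound for `∑ min (x / m, 1 / ‖αLm‖)`, with the minimum replaced by an arbitrary
`t m` below both quantities. -/
lemma sum_le_of_le_div_of_mul_abs_sub_round_le {α : ℝ} {a : ℤ} {q L N : ℕ} (hq : 1 ≤ q)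
    (hL : 0 < L) (hcop : Int.gcd a q = 1) (hα : |α - (a : ℝ) / q| ≤ 1 / (q : ℝ) ^ 2) {x : ℝ}
    (hx : 0 ≤ x) {t : ℕ → ℝ} (ht0 : ∀ m, 0 ≤ t m)
    (htx : ∀ m ∈ Finset.Icc 1 N, t m * m ≤ x)
    (htα : ∀ m ∈ Finset.Icc 1 N, t m * |α * (L * m : ℕ) - round (α * (L * m : ℕ))| ≤ 1) :
    ∑ m ∈ Finset.Icc 1 N, t m ≤
      4 * q + 4 * (2 * (L * N) + q) * (1 + Real.log q) +
        4 * L * (x / q) * (1 + Real.log (L * N : ℕ)) := by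
  have hq0 : (0 : ℝ) < q := by exact_mod_cast hq
  have hq1 : (1 : ℝ) ≤ q := by exact_mod_cast hq
  set K := q / 2 + 1 with hK
  have hKpos : 0 < K := Nat.succ_pos _
  have hKq : (q : ℝ) ≤ 2 * K := by
    have : q ≤ 2 * K := by omega
    exact_mod_cast this
  set H := L * N / K
  have hlogq : 0 ≤ Real.log q := Real.log_nonneg hq1
  have hfar : ∀ m ∈ Finset.Icc 1 N, L * m / K = 0 → t m ≤ 2 * q := by
    intro m hm h0
    have hm1 := (Finset.mem_Icc.mp hm).1
    rw [Nat.div_eq_zero_iff] at h0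
    have hlt : L * m < K := by omega
    have hpos : 0 < L * m := Nat.mul_pos hL hm1
    have h := one_div_two_mul_le_abs_sub_round hq hcop hα (d := (L * m : ℕ))
      (by exact_mod_cast hpos.ne') (by rw [Nat.abs_cast]; omega)
    rw [Int.cast_natCast] at h
    have h' := (mul_le_mul_of_nonneg_left h (ht0 m)).trans (htα m hm)
    rwa [mul_one_div, div_le_one (by positivity)] at h'
  have hnear : ∀ h, 1 ≤ h → ∀ m ∈ Finset.Icc 1 N, L * m / K = h →
      t m ≤ 2 * L * (x / q) * (1 / h) := by
    intro h hh m hm hmh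
    have hm1 : (1 : ℝ) ≤ m := by exact_mod_cast (Finset.mem_Icc.mp hm).1
    have hh0 : (0 : ℝ) < h := by exact_mod_cast hh
    have hle : h * K ≤ L * m := by rw [← hmh]; exact Nat.div_mul_le_self _ _
    have hleR : (h : ℝ) * K ≤ L * m := by exact_mod_cast hle
    have hhq : (h : ℝ) * q ≤ 2 * L * m := by nlinarith
    have htm := htx m hm
    rw [show 2 * L * (x / q) * (1 / h) = 2 * L * x / (h * q) by field_simp,
      le_div_iff₀ (by positivity)]
    calc t m * (h * q) ≤ t m * (2 * L * m) := mul_le_mul_of_nonneg_left hhq (ht0 m)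
      _ = 2 * L * (t m * m) := by ring
      _ ≤ 2 * L * x := by gcongr
  have hblock : ∀ (h : ℕ) (B : ℝ), 0 ≤ B →
      (∀ m ∈ Finset.Icc 1 N, L * m / K = h → t m ≤ B) →
      ∑ m ∈ Finset.Icc 1 N with L * m / K = h, t m ≤ 2 * B + 4 * q * (1 + Real.log q) := by
    intro h B hB htB
    refine sum_le_of_separated (y := fun m => α * (L * m : ℕ)) hq hB ?_ (fun m _ => ht0 m) ?_ ?_
    · intro i hi j hj hij
      have hi' := (Finset.mem_filter.mp hi).2
      have hj' := (Finset.mem_filter.mp hj).2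
      have hne : L * i ≠ L * j := fun h => hij (Nat.eq_of_mul_eq_mul_left hL h)
      have hi₁ := Nat.div_add_mod (L * i) K
      have hj₁ := Nat.div_add_mod (L * j) K
      have hi₂ := Nat.mod_lt (L * i) hKpos
      have hj₂ := Nat.mod_lt (L * j) hKpos
      rw [hi'] at hi₁
      rw [hj'] at hj₁
      have hdq : 2 * |((L * i : ℕ) : ℤ) - (L * j : ℕ)| ≤ q := by
        rcases abs_cases (((L * i : ℕ) : ℤ) - (L * j : ℕ)) with h | h <;> omega
      have := one_div_two_mul_le_abs_sub_round hq hcop hα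
        (d := ((L * i : ℕ) : ℤ) - (L * j : ℕ)) (by omega) hdq
      simpa [mul_sub] using this
    · intro m hm
      obtain ⟨hm, hmh⟩ := Finset.mem_filter.mp hm
      exact htB m hm hmh
    · intro m hm
      exact htα m (Finset.mem_filter.mp hm).1
  have hmaps : ∀ m ∈ Finset.Icc 1 N, L * m / K ∈ Finset.range (H + 1) := by
    intro m hm
    refine Finset.mem_range.mpr (Nat.lt_succ_of_le (Nat.div_le_div_right ?_))
    exact Nat.mul_le_mul_left _ (Finset.mem_Icc.mp hm).2
  have hHq : (H : ℝ) * q ≤ 2 * (L * N) := by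
    have h₁ : H * K ≤ L * N := Nat.div_mul_le_self _ _
    have h₂ : (H : ℝ) * K ≤ L * N := by exact_mod_cast h₁
    have h₃ : (0 : ℝ) ≤ H := H.cast_nonneg
    nlinarith
  have hlogH : Real.log H ≤ Real.log (L * N : ℕ) := by
    rcases Nat.eq_zero_or_pos H with h0 | h0
    · rw [h0, Nat.cast_zero, Real.log_zero]
      exact Real.log_natCast_nonneg _
    · refine Real.log_le_log (by exact_mod_cast h0) ?_
      exact_mod_cast Nat.div_le_self _ _
  rw [← Finset.sum_fiberwise_of_maps_to hmaps, Finset.range_eq_Ico,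
    Finset.sum_eq_sum_Ico_succ_bot (Nat.succ_pos H)]
  have hzero := hblock 0 (2 * q) (by positivity) hfar
  have hrest : ∑ h ∈ Finset.Ico (0 + 1) (H + 1), ∑ m ∈ Finset.Icc 1 N with L * m / K = h, t m ≤
      ∑ h ∈ Finset.Icc 1 H, (4 * L * (x / q) * (1 / (h : ℝ)) + 4 * q * (1 + Real.log q)) := by
    rw [show Finset.Ico (0 + 1) (H + 1) = Finset.Icc 1 H from rfl]
    refine Finset.sum_le_sum fun h hh => ?_
    have := hblock h _ (by positivity) (hnear h (Finset.mem_Icc.mp hh).1)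
    linarith
  rw [Finset.sum_add_distrib, ← Finset.mul_sum, Finset.sum_const, Nat.card_Icc,
    Nat.add_sub_cancel, nsmul_eq_mul] at hrest
  have hharm : 4 * L * (x / q) * ∑ h ∈ Finset.Icc 1 H, 1 / (h : ℝ) ≤
      4 * L * (x / q) * (1 + Real.log (L * N : ℕ)) := by
    gcongr
    exact (sum_Icc_one_div_le H).trans (by linarith)
  have hcount : (H : ℝ) * (4 * q * (1 + Real.log q)) ≤
      4 * (2 * (L * N)) * (1 + Real.log q) := by
    nlinarith
  linarith

/-- Bilinear-sum auxiliary bound: if `|α - a/q| ≤ 1/q²` with `gcd(a,q)=1`,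
then `∑_{m ≤ M} |∑_{mn ≤ x, A ∣ n} χ(n/A) e(αmn)| ≤ C (M + x/q + q) log(2qx)`. -/
theorem type_I_sum_bound
    (A g : ℕ) (hA : 0 < A) (hg : 0 < g) :
    ∃ C : ℝ, ∀ (χ : DirichletCharacter ℂ g),
      ∀ (α : ℝ) (a : ℤ) (q : ℕ), 1 ≤ q → Int.gcd a q = 1 →
        |α - (a : ℝ) / q| ≤ 1 / (q : ℝ) ^ 2 →
        ∀ x M : ℝ, 2 ≤ x → 1 ≤ M →
          ∑ m ∈ Finset.Icc 1 ⌊M⌋₊,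
            ‖∑ n ∈ (Finset.Icc 1 ⌊x⌋₊).filter
                (fun n : ℕ => ((m * n : ℕ) : ℝ) ≤ x ∧ A ∣ n),
                χ ((n / A : ℕ) : ZMod g) * e (α * (m * n))‖
            ≤ C * (M + x / q + q) * Real.log (2 * q * x) := by
  set L := A * g
  have hL : 0 < L := Nat.mul_pos hA hg
  refine ⟨g * (12 + 16 * L + 4 * L * (L + 2)), ?_⟩
  intro χ α a q hq hcop hα x M hx hM
  have hx0 : 0 ≤ x := by linarith
  have hg1 : (1 : ℝ) ≤ g := by exact_mod_cast hg
  have hg0 : (0 : ℝ) < g := by linarith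
  have hq1 : (1 : ℝ) ≤ q := by exact_mod_cast hq
  have hL1 : (1 : ℝ) ≤ L := by exact_mod_cast hL
  set T : ℕ → ℝ := fun m => ‖∑ n ∈ (Finset.Icc 1 ⌊x⌋₊).filter
    (fun n : ℕ => ((m * n : ℕ) : ℝ) ≤ x ∧ A ∣ n),
      χ ((n / A : ℕ) : ZMod g) * e (α * (m * n))‖
  change ∑ m ∈ Finset.Icc 1 ⌊M⌋₊, T m ≤ _
  have hT0 : ∀ m, 0 ≤ T m := fun m => norm_nonneg _
  have hTle : ∀ m, 0 < m → T m ≤ (⌊x⌋₊ / m / A : ℕ) ∧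
      T m * |α * (L * m : ℕ) - round (α * (L * m : ℕ))| ≤ g :=
    fun m hm => norm_inner_sum_le hA hm χ α hx0
  set N := min ⌊M⌋₊ ⌊x⌋₊
  have hNM : (N : ℝ) ≤ M :=
    (Nat.cast_le.mpr (min_le_left _ _)).trans (Nat.floor_le (by linarith))
  have hNx : (N : ℝ) ≤ x := (Nat.cast_le.mpr (min_le_right _ _)).trans (Nat.floor_le hx0)
  have hN1 : 1 ≤ N := le_min (Nat.le_floor (by simpa using hM))
    (Nat.le_floor (by push_cast; linarith))
  have hsum : ∑ m ∈ Finset.Icc 1 ⌊M⌋₊, T m = g * ∑ m ∈ Finset.Icc 1 N, T m / g := by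
    rw [Finset.mul_sum]
    simp only [mul_div_cancel₀ _ hg0.ne']
    symm
    refine Finset.sum_subset (Finset.Icc_subset_Icc_right (min_le_left _ _)) ?_
    intro m hm hmN
    rw [Finset.mem_Icc] at hm hmN
    have hxm : ⌊x⌋₊ < m := by omega
    have h := (hTle m (by omega)).1
    rw [Nat.div_eq_of_lt hxm, Nat.zero_div, Nat.cast_zero] at h
    exact le_antisymm h (hT0 m)
  have hbound := sum_le_of_le_div_of_mul_abs_sub_round_le (N := N) (t := fun m => T m / g)
    hq hL hcop hα hx0 (fun m => div_nonneg (hT0 m) hg0.le)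
    (by
      intro m hm
      have hm1 := (Finset.mem_Icc.mp hm).1
      have h₁ := (hTle m hm1).1
      have h₂ : ⌊x⌋₊ / m / A * m ≤ ⌊x⌋₊ :=
        (Nat.mul_le_mul_right m (Nat.div_le_self _ _)).trans (Nat.div_mul_le_self _ _)
      have h₃ : ((⌊x⌋₊ / m / A : ℕ) : ℝ) * m ≤ x :=
        le_trans (by exact_mod_cast h₂) (Nat.floor_le hx0)
      calc T m / g * m ≤ T m * m := by
            gcongr
            exact div_le_self (hT0 m) hg1
        _ ≤ (⌊x⌋₊ / m / A : ℕ) * m := by gcongr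
        _ ≤ x := h₃)
    (by
      intro m hm
      rw [div_mul_eq_mul_div, div_le_one hg0]
      exact (hTle m (Finset.mem_Icc.mp hm).1).2)
  set Λ := Real.log (2 * q * x) with hΛ
  have h2qx : 4 ≤ 2 * (q : ℝ) * x := by nlinarith
  have hΛ1 : 1 ≤ Λ := by
    rw [hΛ, Real.le_log_iff_exp_le (by linarith)]
    linarith [Real.exp_one_lt_d9]
  have hlogq : Real.log q ≤ Λ := Real.log_le_log (by linarith) (by nlinarith)
  have hlogx : Real.log x ≤ Λ := Real.log_le_log (by linarith) (by nlinarith)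
  have hlogLN : Real.log (L * N : ℕ) ≤ L + Λ := by
    have hN0 : (0 : ℝ) < N := by exact_mod_cast hN1
    rw [Nat.cast_mul, Real.log_mul (by linarith) hN0.ne']
    have h₁ := Real.log_le_self (show (0 : ℝ) ≤ L by linarith)
    have h₂ := Real.log_le_log hN0 hNx
    linarith
  have hxq : 0 ≤ x / q := by positivity
  have hfirst : 4 * (2 * (L * N) + q) * (1 + Real.log q) ≤
      4 * (2 * (L * M) + q) * (2 * Λ) := by
    have : 0 ≤ Real.log q := Real.log_nonneg hq1
    gcongr
    linarith
  have hsecond : 4 * L * (x / q) * (1 + Real.log (L * N : ℕ)) ≤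
      4 * L * (x / q) * ((L + 2) * Λ) := by
    gcongr
    nlinarith
  have htotal : ∑ m ∈ Finset.Icc 1 N, T m / g ≤
      (12 + 16 * L + 4 * L * (L + 2)) * (M + x / q + q) * Λ := by
    have hcoef : 4 * q + 4 * (2 * (L * M) + q) * 2 + 4 * L * (x / q) * (L + 2) ≤
        (12 + 16 * L + 4 * L * (L + 2)) * (M + x / q + q) := by
      have hdiff : 0 ≤ (12 + 4 * (L : ℝ) * (L + 2)) * M + (12 + 16 * L) * (x / q) +
          (16 * L + 4 * L * (L + 2)) * q := by positivity
      linarith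
    have hmul := mul_le_mul_of_nonneg_right hcoef (show 0 ≤ Λ by linarith)
    have hqΛ : 4 * (q : ℝ) ≤ 4 * q * Λ := by nlinarith
    linarith
  rw [hsum]
  calc (g : ℝ) * ∑ m ∈ Finset.Icc 1 N, T m / g ≤
      g * ((12 + 16 * L + 4 * L * (L + 2)) * (M + x / q + q) * Λ) := by gcongr
    _ = _ := by ring
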